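/- (First variation formula on a Lie algebra.) Let k ≥ 1, t₀ < t₁, let L : (Fin k → 𝔤) → ℝ be smooth, let ξ : ℝ → 𝔤 be smooth with momentum π, and let σ be a variation direction of order k on [t₀,t₁], with induced infinitesimal variation δ_σξ := σ' + [ξ, σ]. Then ∫_{t₀}^{t₁} ∑_{r=1}^{k} ∂_rL(Jξ(t))( (δ_σξ)^{(r−1)}(t) ) dt = ∫_{t₀}^{t₁} ( π(t)([ξ(t), σ(t)]) − π'(t)(σ(t)) ) dt, where π' is the derivative of the 𝔤*-valued curve π. -/

import Mathlib

noncomputable section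

/-- Partial Fréchet derivative in slot `r` of a map defined on `Fin m → E`,
as a continuous linear map (zero junk value for `r ≥ m`). -/
def pd {m : ℕ} {E W : Type*} [NormedAddCommGroup E] [NormedSpace ℝ E]
    [NormedAddCommGroup W] [NormedSpace ℝ W]
    (F : (Fin m → E) → W) (r : ℕ) (A : Fin m → E) : E →L[ℝ] W :=
  if h : r < m then
    (fderiv ℝ F A).comp
      (ContinuousLinearMap.pi (Pi.single (⟨r, h⟩ : Fin m) (ContinuousLinearMap.id ℝ E)))
  else 0

/-- The reduced `k`-jet of a curve: slot `i` (Lean indexing `0,…,k-1`, i.e. the paper's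
slot `r = i+1`) holds the `i`-th derivative. -/
def rjet {E : Type*} [NormedAddCommGroup E] [NormedSpace ℝ E] (k : ℕ) (q : ℝ → E) (t : ℝ) :
    Fin k → E := fun i => iteratedDeriv i q t

section Calculus

variable {E F G : Type*} [NormedAddCommGroup E] [NormedSpace ℝ E]
  [NormedAddCommGroup F] [NormedSpace ℝ F] [NormedAddCommGroup G] [NormedSpace ℝ G]

lemma ContDiff.deriv_top {f : ℝ → E} (hf : ContDiff ℝ (⊤ : ℕ∞) f) :
    ContDiff ℝ (⊤ : ℕ∞) (deriv f) :=
  (contDiff_infty_iff_deriv.1 hf).2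

lemma ContDiff.iteratedDeriv_top {f : ℝ → E} (hf : ContDiff ℝ (⊤ : ℕ∞) f) (n : ℕ) :
    ContDiff ℝ (⊤ : ℕ∞) (iteratedDeriv n f) := by
  rw [iteratedDeriv_eq_iterate]
  exact hf.iterate_deriv n

lemma ContDiff.hasDerivAt_top {f : ℝ → E} (hf : ContDiff ℝ (⊤ : ℕ∞) f) (t : ℝ) :
    HasDerivAt f (deriv f t) t :=
  ((contDiff_infty_iff_deriv.1 hf).1 t).hasDerivAt

/-- If the derivatives of `v` of order at most `n` vanish at `t`, then so does the `n`-th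
derivative of `B (u, v)` for every continuous bilinear map `B`. -/
lemma iteratedDeriv_bilinear_eq_zero (B : E →L[ℝ] F →L[ℝ] G) {t : ℝ} (n : ℕ) :
    ∀ {u : ℝ → E} {v : ℝ → F}, ContDiff ℝ (⊤ : ℕ∞) u → ContDiff ℝ (⊤ : ℕ∞) v →
      (∀ j ≤ n, iteratedDeriv j v t = 0) → iteratedDeriv n (fun s => B (u s) (v s)) t = 0 := by
  induction n with
  | zero =>
    intro u v _ _ h
    have h₀ : v t = 0 := by simpa using h 0 le_rfl
    simp [h₀]
  | succ n ih =>
    intro u v hu hv h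
    have hd : deriv (fun s => B (u s) (v s)) =
        (fun s => B (u s) (deriv v s)) + fun s => B (deriv u s) (v s) := by
      funext s
      exact (B.hasDerivAt_of_bilinear (fun _ => hu.hasDerivAt_top s)
        (fun _ => hv.hasDerivAt_top s)).deriv
    have smooth : ∀ {a : ℝ → E} {b : ℝ → F}, ContDiff ℝ (⊤ : ℕ∞) a →
        ContDiff ℝ (⊤ : ℕ∞) b → ContDiffAt ℝ n (fun s => B (a s) (b s)) t := fun ha hb =>
      (((B.contDiff.comp ha).clm_apply hb).of_le (by exact_mod_cast le_top)).contDiffAt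
    rw [iteratedDeriv_succ', hd,
      iteratedDeriv_add (smooth hu hv.deriv_top) (smooth hu.deriv_top hv),
      ih hu hv.deriv_top fun j hj => by
        rw [← iteratedDeriv_succ']; exact h (j + 1) (by omega),
      ih hu.deriv_top hv fun j hj => h j (by omega), add_zero]

/-- Integration by parts for the pairing of a curve of linear forms with a curve of vectors
vanishing at both ends. -/
lemma integral_clm_deriv_eq_neg {p : ℝ → E →L[ℝ] ℝ} {v : ℝ → E} {a b : ℝ}
    (hp : ContDiff ℝ (⊤ : ℕ∞) p) (hv : ContDiff ℝ (⊤ : ℕ∞) v) (ha : v a = 0) (hb : v b = 0) :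
    (∫ t in a..b, p t (deriv v t)) = -∫ t in a..b, deriv p t (v t) := by
  have h₁ : Continuous fun t => p t (deriv v t) := (hp.clm_apply hv.deriv_top).continuous
  have h₂ : Continuous fun t => deriv p t (v t) := (hp.deriv_top.clm_apply hv).continuous
  have key : (∫ t in a..b, (deriv p t (v t) + p t (deriv v t))) = p b (v b) - p a (v a) :=
    intervalIntegral.integral_eq_sub_of_hasDerivAt
      (fun t _ => (hp.hasDerivAt_top t).clm_apply (hv.hasDerivAt_top t))
      ((h₂.add h₁).intervalIntegrable _ _)
  rw [intervalIntegral.integral_add (h₂.intervalIntegrable _ _) (h₁.intervalIntegrable _ _),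
    ha, hb, map_zero, map_zero] at key
  linarith

lemma integral_clm_iteratedDeriv {a b : ℝ} {v : ℝ → E} (hv : ContDiff ℝ (⊤ : ℕ∞) v) (n : ℕ) :
    ∀ {p : ℝ → E →L[ℝ] ℝ}, ContDiff ℝ (⊤ : ℕ∞) p →
      (∀ j < n, iteratedDeriv j v a = 0 ∧ iteratedDeriv j v b = 0) →
      (∫ t in a..b, p t (iteratedDeriv n v t)) =
        ∫ t in a..b, ((-1 : ℝ) ^ n • iteratedDeriv n p t) (v t) := by
  induction n with
  | zero => intro p _ _; simp
  | succ n ih =>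
    intro p hp h
    rw [iteratedDeriv_succ, integral_clm_deriv_eq_neg hp (hv.iteratedDeriv_top n)
      (h n (by omega)).1 (h n (by omega)).2, ih hp.deriv_top fun j hj => h j (by omega),
      iteratedDeriv_succ', ← intervalIntegral.integral_neg]
    simp [pow_succ]

lemma contDiff_rjet {q : ℝ → E} (hq : ContDiff ℝ (⊤ : ℕ∞) q) (k : ℕ) :
    ContDiff ℝ (⊤ : ℕ∞) (rjet k q) :=
  contDiff_pi.2 fun i => hq.iteratedDeriv_top i

lemma contDiff_pd {m : ℕ} {f : (Fin m → E) → F} (hf : ContDiff ℝ (⊤ : ℕ∞) f) (r : ℕ) :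
    ContDiff ℝ (⊤ : ℕ∞) (pd f r) := by
  unfold pd
  split_ifs
  · exact (hf.fderiv_right (by simp)).clm_comp contDiff_const
  · exact contDiff_const

end Calculus

/-- **First variation formula on a (finite-dimensional, normed) Lie algebra.**
The Lie algebra `𝔤` is modeled as a finite-dimensional real normed space together with a
bilinear bracket `bra` which is skew-symmetric and satisfies the Jacobi identity.
For a smooth Lagrangian `L` on reduced `k`-jets, a smooth curve `ξ` with momentum `π`,
and a variation direction `σ` of order `k` on `[t₀,t₁]` with induced infinitesimal variation
`δ = σ' + [ξ, σ]`, one has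
`∫ ∑_{r=1}^{k} ∂_r L(Jξ t)(δ^{(r-1)} t) dt = ∫ (π t [ξ t, σ t] − π' t (σ t)) dt`. -/
theorem first_variation_lie_algebra {𝔤 : Type*} [NormedAddCommGroup 𝔤] [NormedSpace ℝ 𝔤]
    [FiniteDimensional ℝ 𝔤]
    (bra : 𝔤 →ₗ[ℝ] 𝔤 →ₗ[ℝ] 𝔤)
    (hskew : ∀ x y : 𝔤, bra x y = - bra y x)
    (hjac : ∀ x y z : 𝔤, bra x (bra y z) + bra y (bra z x) + bra z (bra x y) = 0)
    (k : ℕ) (hk : 1 ≤ k) (t₀ t₁ : ℝ) (ht : t₀ < t₁)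
    (L : (Fin k → 𝔤) → ℝ) (hL : ContDiff ℝ (⊤ : ℕ∞) L)
    (ξ : ℝ → 𝔤) (hξ : ContDiff ℝ (⊤ : ℕ∞) ξ)
    (π : ℝ → 𝔤 →L[ℝ] ℝ)
    (hπ : π = fun t => ∑ i ∈ Finset.range k,
        (-1 : ℝ) ^ i • iteratedDeriv i (fun s => pd L i (rjet k ξ s)) t)
    (σ : ℝ → 𝔤) (hσ : ContDiff ℝ (⊤ : ℕ∞) σ)
    (hbd : ∀ j < k, iteratedDeriv j σ t₀ = 0 ∧ iteratedDeriv j σ t₁ = 0)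
    (δ : ℝ → 𝔤) (hδ : δ = fun t => deriv σ t + bra (ξ t) (σ t)) :
    (∫ t in t₀..t₁, ∑ i ∈ Finset.range k, pd L i (rjet k ξ t) (iteratedDeriv i δ t)) =
      ∫ t in t₀..t₁, (π t (bra (ξ t) (σ t)) - deriv π t (σ t)) := by
  set B : 𝔤 →L[ℝ] 𝔤 →L[ℝ] 𝔤 :=
    LinearMap.toContinuousLinearMap (LinearMap.toContinuousLinearMap.toLinearMap ∘ₗ bra)
  have hB : ∀ x y, bra x y = B x y := fun _ _ => rfl
  simp only [hB] at hδ ⊢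
  have hBs : ContDiff ℝ (⊤ : ℕ∞) fun t => B (ξ t) (σ t) := (B.contDiff.comp hξ).clm_apply hσ
  have hδs : ContDiff ℝ (⊤ : ℕ∞) δ := hδ ▸ hσ.deriv_top.add hBs
  have hp : ∀ i, ContDiff ℝ (⊤ : ℕ∞) fun s => pd L i (rjet k ξ s) := fun i =>
    (contDiff_pd hL i).comp (contDiff_rjet hξ k)
  have hπs : ContDiff ℝ (⊤ : ℕ∞) π := by
    rw [hπ]
    exact ContDiff.sum fun i _ => ((hp i).iteratedDeriv_top i).const_smul _
  have hδ₀ : ∀ t, (∀ j < k, iteratedDeriv j σ t = 0) →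
      ∀ j, j + 1 < k → iteratedDeriv j δ t = 0 := by
    intro t hσt j hj
    have hle : ((j : ℕ) : WithTop ℕ∞) ≤ ((⊤ : ℕ∞) : WithTop ℕ∞) := by exact_mod_cast le_top
    rw [hδ, iteratedDeriv_fun_add (hσ.deriv_top.of_le hle).contDiffAt
      (hBs.of_le hle).contDiffAt, ← iteratedDeriv_succ', hσt _ hj,
      iteratedDeriv_bilinear_eq_zero B j hξ hσ fun l hl => hσt l (by omega), add_zero]
  have hσ₀ : σ t₀ = 0 ∧ σ t₁ = 0 := by simpa using hbd 0 hk
  have int : ∀ {p : ℝ → 𝔤 →L[ℝ] ℝ} {v : ℝ → 𝔤}, ContDiff ℝ (⊤ : ℕ∞) p →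
      ContDiff ℝ (⊤ : ℕ∞) v →
      IntervalIntegrable (fun t => p t (v t)) MeasureTheory.volume t₀ t₁ := fun hp hv =>
    (hp.clm_apply hv).continuous.intervalIntegrable _ _
  calc (∫ t in t₀..t₁, ∑ i ∈ Finset.range k, pd L i (rjet k ξ t) (iteratedDeriv i δ t))
      = ∑ i ∈ Finset.range k, ∫ t in t₀..t₁, pd L i (rjet k ξ t) (iteratedDeriv i δ t) :=
        intervalIntegral.integral_finsetSum fun i _ => int (hp i) (hδs.iteratedDeriv_top i)
    _ = ∑ i ∈ Finset.range k, ∫ t in t₀..t₁,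
          ((-1 : ℝ) ^ i • iteratedDeriv i (fun s => pd L i (rjet k ξ s)) t) (δ t) := by
        refine Finset.sum_congr rfl fun i hi => ?_
        rw [Finset.mem_range] at hi
        exact integral_clm_iteratedDeriv hδs i (hp i) fun j hj =>
          ⟨hδ₀ t₀ (fun l hl => (hbd l hl).1) j (by omega),
            hδ₀ t₁ (fun l hl => (hbd l hl).2) j (by omega)⟩
    _ = ∫ t in t₀..t₁, π t (δ t) := by
        rw [← intervalIntegral.integral_finsetSum fun i _ =>
          int (((hp i).iteratedDeriv_top i).const_smul _) hδs]
        simp [hπ]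
    _ = (∫ t in t₀..t₁, π t (deriv σ t)) + ∫ t in t₀..t₁, π t (B (ξ t) (σ t)) := by
        rw [← intervalIntegral.integral_add (int hπs hσ.deriv_top) (int hπs hBs)]
        simp [hδ]
    _ = ∫ t in t₀..t₁, (π t (B (ξ t) (σ t)) - deriv π t (σ t)) := by
        rw [integral_clm_deriv_eq_neg hπs hσ hσ₀.1 hσ₀.2,
          intervalIntegral.integral_sub (int hπs hBs) (int hπs.deriv_top hσ)]
        ring
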